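/- Let G be a connected graph of order n ≥ 3 with γ_ri2(G) = n − 1, and let x be a vertex of G of degree at least 3. Then the neighborhood N_G(x) contains at most two vertices of degree 2 in G, and if it contains exactly two vertices of degree 2, then these two vertices are adjacent in G. -/

import Mathlib

open scoped Classical

/-- A `k`-rainbow independent dominating function of `G`: values in `{0,...,k}`,
each nonzero colour class is independent, and every vertex of value `0` has,
for each `i ∈ {1,...,k}`, a neighbor of value `i`. -/
def IsKRiDF {V : Type*} (G : SimpleGraph V) (k : ℕ) (f : V → ℕ) : Prop :=
  (∀ v, f v ≤ k) ∧
  (∀ i, 1 ≤ i → i ≤ k → ∀ u v, f u = i → f v = i → ¬ G.Adj u v) ∧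
  (∀ v, f v = 0 → ∀ i, 1 ≤ i → i ≤ k → ∃ u, G.Adj v u ∧ f u = i)

/-- The weight of a labelling: the number of vertices with nonzero value. -/
noncomputable def riWeight {V : Type*} [Fintype V] (f : V → ℕ) : ℕ :=
  (Finset.univ.filter fun v => f v ≠ 0).card

/-- The `k`-rainbow independent domination number. -/
noncomputable def riNumber {V : Type*} [Fintype V] (G : SimpleGraph V) (k : ℕ) : ℕ :=
  sInf {w | ∃ f, IsKRiDF G k f ∧ riWeight f = w}

/-- The star `S_m = K_{1,m}` on `Fin (m+1)` with centre `0`. -/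
def starGraph (m : ℕ) : SimpleGraph (Fin (m + 1)) :=
  SimpleGraph.fromRel (fun a b => (a : ℕ) = 0 ∧ (b : ℕ) ≠ 0)

/-- The star `S_m` with one extra edge between the leaves `1` and `2`. -/
def starPlusGraph (m : ℕ) : SimpleGraph (Fin (m + 1)) :=
  SimpleGraph.fromRel (fun a b => ((a : ℕ) = 0 ∧ (b : ℕ) ≠ 0) ∨ ((a : ℕ) = 1 ∧ (b : ℕ) = 2))

/-- The double star `S(n,m)`: centres `0` (with leaves `2,...,n+1`) and `1`
(with leaves `n+2,...,n+m+1`), joined by the bridge `01`. -/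
def doubleStar (n m : ℕ) : SimpleGraph (Fin (n + m + 2)) :=
  SimpleGraph.fromRel (fun a b =>
    ((a : ℕ) = 0 ∧ (b : ℕ) = 1) ∨
    ((a : ℕ) = 0 ∧ 2 ≤ (b : ℕ) ∧ (b : ℕ) < n + 2) ∨
    ((a : ℕ) = 1 ∧ n + 2 ≤ (b : ℕ)))

/-- An independent set disjoint from `B` extends to one that is maximal among those
disjoint from `B`. -/
theorem exists_indep_extension {V : Type*} [Finite V] (G : SimpleGraph V) {A B : Set V}
    (hA : G.IsIndepSet A) (hAB : Disjoint A B) :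
    ∃ A', A ⊆ A' ∧ G.IsIndepSet A' ∧ Disjoint A' B ∧
      ∀ v, v ∉ A' → v ∉ B → ∃ u ∈ A', G.Adj v u := by
  obtain ⟨A', hle, hmax⟩ :=
    Finite.exists_le_maximal (p := fun S : Set V => G.IsIndepSet S ∧ Disjoint S B) ⟨hA, hAB⟩
  refine ⟨A', hle, hmax.prop.1, hmax.prop.2, fun v hv hvB => ?_⟩
  by_contra! h
  refine hv (hmax.le_of_ge (y := insert v A') ⟨?_, ?_⟩ (Set.subset_insert v A')
    (Set.mem_insert v A'))
  · exact hmax.prop.1.insert fun u hu _ => ⟨h u hu, fun huv => h u hu huv.symm⟩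
  · exact Set.disjoint_insert_left.2 ⟨hvB, hmax.prop.2⟩

/-- If two distinct vertices both have a neighbor in each of two disjoint independent sets,
then the 2-rainbow independent domination number is at most the order minus two. -/
theorem riNumber_two_add_two_le {V : Type*} [Fintype V] (G : SimpleGraph V) {A B : Set V}
    (hA : G.IsIndepSet A) (hB : G.IsIndepSet B) (hAB : Disjoint A B) {u v : V} (huv : u ≠ v)
    (huA : ∃ p ∈ A, G.Adj u p) (huB : ∃ p ∈ B, G.Adj u p)
    (hvA : ∃ p ∈ A, G.Adj v p) (hvB : ∃ p ∈ B, G.Adj v p) :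
    riNumber G 2 + 2 ≤ Fintype.card V := by
  obtain ⟨A', hAA', hA', hA'B, hmaxA⟩ := exists_indep_extension G hA hAB
  obtain ⟨B', hBB', hB', hB'A', hmaxB⟩ := exists_indep_extension G hB hA'B.symm
  have notMem {S T : Set V} (hS : S ⊆ T) (hT : G.IsIndepSet T) {w : V}
      (hw : ∃ p ∈ S, G.Adj w p) : w ∉ T := by
    obtain ⟨p, hp, hwp⟩ := hw
    exact fun hwT => hT hwT (hS hp) hwp.ne hwp
  let f : V → ℕ := fun w => if w ∈ A' then 1 else if w ∈ B' then 2 else 0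
  have f_one {w : V} : f w = 1 ↔ w ∈ A' := by
    simp only [f]; split_ifs <;> simp_all
  have f_two {w : V} : f w = 2 ↔ w ∈ B' := by
    have : w ∈ A' → w ∉ B' := fun h h' => Set.disjoint_left.1 hB'A' h' h
    simp only [f]; split_ifs <;> simp_all
  have f_zero {w : V} : f w = 0 ↔ w ∉ A' ∧ w ∉ B' := by
    simp only [f]; split_ifs <;> simp_all
  have hf : IsKRiDF G 2 f := by
    refine ⟨fun w => ?_, fun i h1 h2 a b ha hb hab => ?_, fun w hw i h1 h2 => ?_⟩
    · simp only [f]; split_ifs <;> simp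
    · interval_cases i
      · exact hA' (f_one.1 ha) (f_one.1 hb) hab.ne hab
      · exact hB' (f_two.1 ha) (f_two.1 hb) hab.ne hab
    · obtain ⟨hwA, hwB⟩ := f_zero.1 hw
      interval_cases i
      · obtain ⟨p, hp, hwp⟩ := hmaxA w hwA fun h => hwB (hBB' h)
        exact ⟨p, hwp, f_one.2 hp⟩
      · obtain ⟨p, hp, hwp⟩ := hmaxB w hwB hwA
        exact ⟨p, hwp, f_two.2 hp⟩
  have hle : riNumber G 2 ≤ riWeight f := Nat.sInf_le ⟨f, hf, rfl⟩
  have hzero : ({u, v} : Finset V) ⊆ Finset.univ.filter fun w => ¬ f w ≠ 0 := by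
    intro w hw
    rw [Finset.mem_filter, not_not, f_zero]
    rcases Finset.mem_insert.1 hw with rfl | hw
    · exact ⟨Finset.mem_univ _, notMem hAA' hA' huA, notMem hBB' hB' huB⟩
    · rw [Finset.mem_singleton.1 hw]
      exact ⟨Finset.mem_univ _, notMem hAA' hA' hvA, notMem hBB' hB' hvB⟩
  have htwo := Finset.card_le_card hzero
  rw [Finset.card_pair huv] at htwo
  have hsum := Finset.card_filter_add_card_filter_not (s := (Finset.univ : Finset V))
    fun w => f w ≠ 0
  rw [Finset.card_univ] at hsum
  unfold riWeight at hle
  omega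

/-- Two distinct vertices with a common neighbor `p` have no further neighbors `q`, `r` that
are equal or nonadjacent, when the 2-rainbow independent domination number is at least the
order minus one. -/
theorem adj_of_common_neighbor {V : Type*} [Fintype V] {G : SimpleGraph V}
    (hG : Fintype.card V < riNumber G 2 + 2) {u v p q r : V} (huv : u ≠ v)
    (hup : G.Adj u p) (hvp : G.Adj v p) (huq : G.Adj u q) (hvr : G.Adj v r)
    (hqp : q ≠ p) (hrp : r ≠ p) : G.Adj q r := by
  by_contra hqr
  refine hG.not_ge (riNumber_two_add_two_le G (A := {p}) (B := {q, r}) ?_ ?_ ?_ huv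
    ⟨p, rfl, hup⟩ ⟨q, by simp, huq⟩ ⟨p, rfl, hvp⟩ ⟨r, by simp, hvr⟩)
  · exact Set.pairwise_singleton _ _
  · exact Set.pairwise_pair.2 fun _ => ⟨hqr, fun h => hqr h.symm⟩
  · simp [hqp.symm, hrp.symm]

/-- A neighbor of `x` of degree two has exactly one other neighbor. -/
theorem exists_other_neighbor {V : Type*} [Fintype V] {G : SimpleGraph V} {x a : V}
    (hxa : G.Adj x a) (ha : G.degree a = 2) :
    ∃ a', a' ≠ x ∧ ∀ w, G.Adj a w ↔ w = x ∨ w = a' := by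
  obtain ⟨s, t, hst, hN⟩ := Finset.card_eq_two.1 ha
  have hmem (w : V) : G.Adj a w ↔ w = s ∨ w = t := by
    rw [← G.mem_neighborFinset, hN, Finset.mem_insert, Finset.mem_singleton]
  rcases (hmem x).1 hxa.symm with rfl | rfl
  · exact ⟨t, hst.symm, hmem⟩
  · exact ⟨s, hst, fun w => (hmem w).trans or_comm⟩

/-- When the 2-rainbow independent domination number is at least the order minus one, any two
neighbors of degree two of a vertex of degree at least three are adjacent. -/
theorem adj_of_degree_eq_two {V : Type*} [Fintype V] {G : SimpleGraph V}
    (hG : Fintype.card V < riNumber G 2 + 2) {x a b : V} (hx : 3 ≤ G.degree x)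
    (hxa : G.Adj x a) (hxb : G.Adj x b) (ha : G.degree a = 2) (hb : G.degree b = 2)
    (hab : a ≠ b) : G.Adj a b := by
  by_contra hnab
  obtain ⟨a', hax, hNa⟩ := exists_other_neighbor hxa ha
  obtain ⟨b', hbx, hNb⟩ := exists_other_neighbor hxb hb
  have haa' : G.Adj a a' := (hNa a').2 (Or.inr rfl)
  have hbb' : G.Adj b b' := (hNb b').2 (Or.inr rfl)
  have ha'b : a' ≠ b := fun h => hnab (h ▸ haa')
  have hb'a : b' ≠ a := fun h => hnab (h ▸ hbb'.symm)
  have hab' : G.Adj a' b' :=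
    adj_of_common_neighbor hG hab hxa.symm hxb.symm haa' hbb' hax hbx
  have hxa' : ¬ G.Adj x a' := fun h => by
    have hba' := adj_of_common_neighbor hG hbx.symm h hab'.symm hxb hbb'.symm ha'b.symm ha'b.symm
    exact hba'.ne rfl
  have hxb' : ¬ G.Adj x b' := fun h => by
    have hab'' := adj_of_common_neighbor hG hax.symm h hab' hxa haa'.symm hb'a.symm hb'a.symm
    exact hab''.ne rfl
  obtain ⟨c, hc, hcab⟩ := Finset.exists_mem_notMem_of_card_lt_card
    (s := {a, b}) (t := G.neighborFinset x) (Finset.card_le_two.trans_lt hx)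
  rw [G.mem_neighborFinset] at hc
  simp only [Finset.mem_insert, Finset.mem_singleton, not_or] at hcab
  have hcb' : G.Adj c b' :=
    adj_of_common_neighbor hG hax.symm hxa haa'.symm hc hab' hcab.1 hb'a
  have hca' : G.Adj c a' :=
    adj_of_common_neighbor hG hbx.symm hxb hbb'.symm hc hab'.symm hcab.2 ha'b
  exact (adj_of_common_neighbor hG hax.symm hxa haa'.symm hc hca'.symm hcab.1 hcab.1).ne rfl

theorem stmt_16 {V : Type*} [Fintype V] (G : SimpleGraph V) (n : ℕ)
    (hcard : Fintype.card V = n) (hn : 3 ≤ n) (hconn : G.Connected)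
    (hri : riNumber G 2 = n - 1)
    (x : V) (hx : 3 ≤ G.degree x) :
    ((G.neighborFinset x).filter fun y => G.degree y = 2).card ≤ 2 ∧
    (((G.neighborFinset x).filter fun y => G.degree y = 2).card = 2 →
      ∀ a ∈ (G.neighborFinset x).filter fun y => G.degree y = 2,
        ∀ b ∈ (G.neighborFinset x).filter fun y => G.degree y = 2,
          a ≠ b → G.Adj a b) := by
  have hG : Fintype.card V < riNumber G 2 + 2 := by omega
  have hadj : ∀ a ∈ (G.neighborFinset x).filter fun y => G.degree y = 2,
      ∀ b ∈ (G.neighborFinset x).filter fun y => G.degree y = 2, a ≠ b → G.Adj a b := by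
    intro a ha b hb hab
    rw [Finset.mem_filter, G.mem_neighborFinset] at ha hb
    exact adj_of_degree_eq_two hG hx ha.1 hb.1 ha.2 hb.2 hab
  refine ⟨?_, fun _ => hadj⟩
  by_contra! h
  obtain ⟨a, b, c, ha, hb, hc, hab, hac, hbc⟩ := Finset.two_lt_card_iff.1 h
  have hxa := Finset.mem_filter.1 ha
  have hxb := Finset.mem_filter.1 hb
  have hxc := Finset.mem_filter.1 hc
  rw [G.mem_neighborFinset] at hxa hxb hxc
  obtain ⟨a', -, hNa⟩ := exists_other_neighbor hxa.1 hxa.2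
  have hb' := ((hNa b).1 (hadj a ha b hb hab)).resolve_left hxb.1.ne'
  have hc' := ((hNa c).1 (hadj a ha c hc hac)).resolve_left hxc.1.ne'
  exact hbc (hb'.trans hc'.symm)
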